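/- For a finite group G and field k of characteristic 0, the element e_T = κ_ρ⁻¹ Σ_{v∈V(T)} Σ_{h∈H(T)} sgn(v)·vh of the group algebra k[𝔖_n] (the Young symmetrizer associated to a Young tableau T of shape ρ, normalized by the hook length product κ_ρ) is an idempotent. -/

import Mathlib

namespace Stmt6

variable {n : ℕ}

/-- The subgroup of permutations of `Fin n` preserving a labelling `r : Fin n → ℕ`
(for `r` the row (resp. column) coordinate of a Young tableau, this is the horizontal
subgroup `H(T)` (resp. vertical subgroup `V(T)`)). -/
def stabOf (r : Fin n → ℕ) : Subgroup (Equiv.Perm (Fin n)) where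
  carrier := {σ | ∀ x, r (σ x) = r x}
  one_mem' := fun _ => rfl
  mul_mem' := by
    intro a b ha hb x
    simpa [Equiv.Perm.mul_apply, hb x] using ha (b x)
  inv_mem' := by
    intro a ha x
    simpa using (ha (a⁻¹ x)).symm

open scoped Classical in
/-- The Young symmetrizer `e_T = κ_ρ⁻¹ Σ_{v ∈ V(T)} Σ_{h ∈ H(T)} sgn(v) · v h` in the group
algebra `k[𝔖_n]`, for a Young tableau `T` (a bijective filling of the cells of a Young diagram
`μ` with `n = |μ|` boxes), normalized by the product `κ_ρ` of the hook lengths of `μ`. -/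
noncomputable def youngSymmetrizer (k : Type*) [Field k] (μ : YoungDiagram)
    (T : {c // c ∈ μ.cells} ≃ Fin n) : MonoidAlgebra k (Equiv.Perm (Fin n)) :=
  let row : Fin n → ℕ := fun x => ((T.symm x : ℕ × ℕ)).1
  let col : Fin n → ℕ := fun x => ((T.symm x : ℕ × ℕ)).2
  let κ : ℕ := ∏ c ∈ μ.cells, ((μ.rowLen c.1 - c.2) + (μ.colLen c.2 - c.1) - 1)
  (κ : k)⁻¹ • ∑ v ∈ Finset.univ.filter (· ∈ stabOf col),
      ∑ h ∈ Finset.univ.filter (· ∈ stabOf row),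
        MonoidAlgebra.single (v * h) (((Equiv.Perm.sign v : ℤˣ) : ℤ) : k)

section aux
open Equiv Finset

section gen
variable {α : Type} [Fintype α] [DecidableEq α]

/-- permutations preserving a labelling, as a finset -/
def VS (r : α → ℕ) : Finset (Perm α) := univ.filter (fun σ => ∀ x, r (σ x) = r x)

lemma mem_VS {r : α → ℕ} {σ : Perm α} : σ ∈ VS r ↔ ∀ x, r (σ x) = r x := by simp [VS]

lemma one_VS (r : α → ℕ) : (1 : Perm α) ∈ VS r := by simp [mem_VS]

lemma mul_VS {r : α → ℕ} {σ τ : Perm α} (h : σ ∈ VS r) (h' : τ ∈ VS r) : σ * τ ∈ VS r := by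
  rw [mem_VS] at *
  intro x
  rw [Perm.mul_apply, h, h']

lemma inv_VS {r : α → ℕ} {σ : Perm α} (h : σ ∈ VS r) : σ⁻¹ ∈ VS r := by
  rw [mem_VS] at *
  intro x
  have := h (σ⁻¹ x)
  simpa using this.symm

lemma swap_VS {r : α → ℕ} {x y : α} (h : r x = r y) : swap x y ∈ VS r := by
  rw [mem_VS]
  intro z
  rw [swap_apply_def]
  split_ifs with h1 h2
  · rw [h1, h]
  · rw [h2, h]
  · rfl

lemma sum_VS_inv {M : Type*} [AddCommMonoid M] (r : α → ℕ) (F : Perm α → M) :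
    ∑ v ∈ VS r, F v = ∑ v ∈ VS r, F v⁻¹ := by
  refine Finset.sum_bij' (fun v _ => v⁻¹) (fun v _ => v⁻¹) ?_ ?_ ?_ ?_ ?_ <;> simp +contextual [inv_VS]

lemma sum_VS_mul_right {M : Type*} [AddCommMonoid M] (r : α → ℕ) (F : Perm α → M) {t : Perm α}
    (ht : t ∈ VS r) :
    ∑ v ∈ VS r, F v = ∑ v ∈ VS r, F (v * t) := by
  refine Finset.sum_bij' (fun v _ => v * t⁻¹) (fun v _ => v * t) ?_ ?_ ?_ ?_ ?_ <;>
    simp +contextual [inv_VS, mul_VS, ht]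

lemma sum_VS_mul_left {M : Type*} [AddCommMonoid M] (r : α → ℕ) (F : Perm α → M) {t : Perm α}
    (ht : t ∈ VS r) :
    ∑ v ∈ VS r, F v = ∑ v ∈ VS r, F (t * v) := by
  refine Finset.sum_bij' (fun v _ => t⁻¹ * v) (fun v _ => t * v) ?_ ?_ ?_ ?_ ?_ <;>
    simp +contextual [inv_VS, mul_VS, ht]

lemma sum_VS_equiv {β : Type} [Fintype β] [DecidableEq β] {M : Type*} [AddCommMonoid M]
    (e : α ≃ β) (r : β → ℕ) (F : Perm β → M) :
    ∑ v ∈ VS r, F v = ∑ v ∈ VS (r ∘ e), F (e.permCongr v) := by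
  refine Finset.sum_bij' (fun v _ => e.symm.permCongr v) (fun v _ => e.permCongr v) ?_ ?_ ?_ ?_ ?_
  · intro v hv
    rw [mem_VS] at *
    intro x
    simp [Equiv.permCongr_apply, hv]
  · intro v hv
    rw [mem_VS] at *
    intro x
    have := hv (e.symm x)
    simpa [Equiv.permCongr_apply] using this
  · intro v _; ext; simp [Equiv.permCongr_apply]
  · intro v _; ext; simp [Equiv.permCongr_apply]
  · intro v _
    congr 1
    ext; simp [Equiv.permCongr_apply]

/-- A filling with injective coordinates whose set of coordinates is a Young diagram. -/
structure IsShape (row col : α → ℕ) : Prop where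
  inj : ∀ x y, row x = row y → col x = col y → x = y
  lower : ∀ x i j, i ≤ row x → j ≤ col x → ∃ y, row y = i ∧ col y = j

/-- number of colourings fixed by a permutation -/
def fx (N : ℕ) (g : Perm α) : ℕ := (univ.filter (fun f : α → Fin N => f ∘ g = f)).card

/-- trace of the Young symmetrizer on tensor space -/
def Z (N : ℕ) (row col : α → ℕ) : ℤ :=
  ∑ v ∈ VS col, ∑ h ∈ VS row, ((Perm.sign v : ℤˣ) : ℤ) * (fx N (v * h) : ℤ)

lemma fx_equiv {β : Type} [Fintype β] [DecidableEq β] (N : ℕ) (e : α ≃ β) (g : Perm α) :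
    fx N (e.permCongr g) = fx N g := by
  unfold fx
  refine Finset.card_bij' (fun f _ => f ∘ e) (fun f _ => f ∘ e.symm) ?_ ?_ ?_ ?_
  · intro f hf
    simp only [mem_filter, mem_univ, true_and] at *
    funext x
    have := congrFun hf (e x)
    simpa [Equiv.permCongr_apply] using this
  · intro f hf
    simp only [mem_filter, mem_univ, true_and] at *
    funext x
    have := congrFun hf (e.symm x)
    simpa [Equiv.permCongr_apply] using this
  · intro f _; funext x; simp
  · intro f _; funext x; simp

lemma Z_equiv {β : Type} [Fintype β] [DecidableEq β] (N : ℕ) (e : α ≃ β) (row col : β → ℕ) :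
    Z N row col = Z N (row ∘ e) (col ∘ e) := by
  unfold Z
  rw [sum_VS_equiv e]
  refine Finset.sum_congr rfl fun v _ => ?_
  rw [sum_VS_equiv e]
  refine Finset.sum_congr rfl fun h _ => ?_
  have : e.permCongr v * e.permCongr h = e.permCongr (v * h) := by
    ext; simp [Equiv.permCongr_apply]
  rw [this, fx_equiv, Perm.sign_permCongr]

end gen

section opt
variable {β : Type} [Fintype β] [DecidableEq β]

lemma fx_opt_none (N : ℕ) (ρ : Perm β) : fx N (optionCongr ρ : Perm (Option β)) = N * fx N ρ := by
  unfold fx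
  have hN : N * (univ.filter (fun f : β → Fin N => f ∘ ρ = f)).card =
      ((univ : Finset (Fin N)) ×ˢ (univ.filter (fun f : β → Fin N => f ∘ ρ = f))).card := by
    simp [Finset.card_product]
  rw [hN]
  refine Finset.card_bij' (fun f _ => (f none, f ∘ some)) (fun p _ => fun o => o.elim p.1 p.2)
    ?_ ?_ ?_ ?_
  · intro f hf
    simp only [mem_filter, mem_univ, true_and, mem_product] at *
    funext x
    have := congrFun hf (some x)
    simpa using this
  · intro f hf
    simp only [mem_filter, mem_univ, true_and, mem_product] at *
    funext x
    rcases x with _ | x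
    · simp
    · have := congrFun hf x
      simpa using this
  · intro f _; funext x; rcases x with _ | x <;> simp
  · intro f _; rfl

lemma fx_opt_some (N : ℕ) (ρ : Perm (Option β)) (π : Perm β) (y : β) (h1 : ρ none = some y)
    (h2 : ∀ a, ρ (some a) = some (π a) ∨ (ρ (some a) = none ∧ π a = y)) : fx N ρ = fx N π := by
  unfold fx
  refine Finset.card_bij' (fun f _ => f ∘ some) (fun p _ => fun o => o.elim (p y) p)
    ?_ ?_ ?_ ?_
  · intro f hf
    simp only [mem_filter, mem_univ, true_and] at *
    funext x
    have h0 := congrFun hf none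
    have := congrFun hf (some x)
    rcases h2 x with h | ⟨h, h'⟩
    · simpa [h] using this
    · simp_all
  · intro f hf
    simp only [mem_filter, mem_univ, true_and] at *
    funext x
    rcases x with _ | x
    · simp [h1]
    · have := congrFun hf x
      rcases h2 x with h | ⟨h, h'⟩
      · simpa [h] using this
      · simp_all
  · intro f hf
    simp only [mem_filter, mem_univ, true_and] at *
    funext x
    rcases x with _ | x
    · have h0 := congrFun hf none
      simp_all
    · simp
  · intro f _; rfl

lemma sum_VS_option {M : Type*} [AddCommMonoid M] (r : Option β → ℕ) (F : Perm (Option β) → M) :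
    ∑ v ∈ VS r, F v = ∑ σ ∈ VS (r ∘ some),
      (F (optionCongr σ) + ∑ y ∈ univ.filter (fun y : β => r (some y) = r none),
        F (swap none (some y) * optionCongr σ)) := by
  have key : ∀ σ : Perm β, ∀ y : Option β, (swap none y * optionCongr σ : Perm (Option β)) ∈ VS r ↔
      σ ∈ VS (r ∘ some) ∧ r y = r none := by
    intro σ y
    constructor
    · intro h
      have hy : r y = r none := by
        have := (mem_VS.1 h) none
        simpa using this
      refine ⟨?_, hy⟩
      have h2 : (swap none y : Perm (Option β)) ∈ VS r := swap_VS hy.symm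
      have h3 := mul_VS h2 h
      rw [← mul_assoc, swap_mul_self, one_mul] at h3
      rw [mem_VS] at *
      intro x
      simpa using h3 (some x)
    · rintro ⟨h, hy⟩
      refine mul_VS (swap_VS hy.symm) ?_
      rw [mem_VS] at *
      intro x
      rcases x with _ | x
      · simp
      · simpa using h x
  have h1 : ∑ v ∈ VS r, F v = ∑ σ : Perm β, ∑ y : Option β,
      if (σ ∈ VS (r ∘ some) ∧ r y = r none) then F (swap none y * optionCongr σ) else 0 := by
    rw [VS, Finset.sum_filter, ← Perm.decomposeOption.symm.sum_comp, Fintype.sum_prod_type,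
      Finset.sum_comm]
    refine Finset.sum_congr rfl fun σ _ => Finset.sum_congr rfl fun y _ => ?_
    rw [Perm.decomposeOption_symm_apply]
    refine if_congr ?_ rfl rfl
    rw [← key, mem_VS]
  rw [h1, ← Finset.sum_filter_add_sum_filter_not univ (fun σ => σ ∈ VS (r ∘ some)),
    Finset.sum_eq_zero (s := univ.filter (fun σ => ¬ σ ∈ VS (r ∘ some))), add_zero]
  swap
  · intro σ hσ
    simp only [mem_filter, mem_univ, true_and] at hσ
    simp [hσ]
  have h2 : univ.filter (fun σ => σ ∈ VS (r ∘ some)) = VS (r ∘ some) := by ext; simp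
  rw [h2]
  refine Finset.sum_congr rfl fun σ h => ?_
  rw [Fintype.sum_option]
  have h3 : (Equiv.refl (Option β) * optionCongr σ : Perm (Option β)) = optionCongr σ := one_mul _
  simp [h, Finset.sum_filter, h3]

lemma sum_VS_option' {M : Type*} [AddCommMonoid M] (r : Option β → ℕ) (F : Perm (Option β) → M) :
    ∑ v ∈ VS r, F v = ∑ σ ∈ VS (r ∘ some),
      (F (optionCongr σ) + ∑ y ∈ univ.filter (fun y : β => r (some y) = r none),
        F (optionCongr σ * swap none (some y))) := by
  rw [sum_VS_inv, sum_VS_option, sum_VS_inv]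
  refine Finset.sum_congr rfl fun σ _ => ?_
  have h : ((optionCongr σ⁻¹ : Perm (Option β)))⁻¹ = optionCongr σ := by
    rw [inv_eq_iff_eq_inv]; rfl
  simp only [mul_inv_rev, swap_inv, h]

lemma Z_vanish (N : ℕ) (row col : β → ℕ) (y z w : β) (h1 : row w = row z) (h2 : col w = col y)
    (hyz : y ≠ z) (hwy : w ≠ y) (hwz : w ≠ z) :
    ∑ σ ∈ VS col, ∑ τ ∈ VS row,
      ((Perm.sign σ : ℤˣ) : ℤ) * (fx N (σ * swap z y * τ) : ℤ) = 0 := by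
  have key : ∑ σ ∈ VS col, ∑ τ ∈ VS row,
      ((Perm.sign σ : ℤˣ) : ℤ) * (fx N (σ * swap z y * τ) : ℤ) =
      - ∑ σ ∈ VS col, ∑ τ ∈ VS row,
      ((Perm.sign σ : ℤˣ) : ℤ) * (fx N (σ * swap z y * τ) : ℤ) := by
    conv_lhs => rw [sum_VS_mul_right col _ (swap_VS (r := col) h2)]
    rw [← Finset.sum_neg_distrib]
    refine Finset.sum_congr rfl fun σ _ => ?_
    rw [sum_VS_mul_left row _ (swap_VS (r := row) h1), ← Finset.sum_neg_distrib]
    refine Finset.sum_congr rfl fun τ _ => ?_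
    have e : swap w y * swap z y * swap w z = swap z y := by
      rw [swap_comm z y, swap_comm w z, ← swap_mul_swap_mul_swap hwy hwz]
      simp [mul_assoc]
    have e2 : σ * swap w y * swap z y * (swap w z * τ) = σ * swap z y * τ := by
      conv_rhs => rw [← e]
      simp only [mul_assoc]
    rw [e2, Perm.sign_mul, Perm.sign_swap hwy]
    simp
  linarith

lemma fx_conj1 (N : ℕ) (σ τ : Perm β) (y : β) :
    fx N (optionCongr σ * (swap none (some y) * optionCongr τ) : Perm (Option β)) =
      fx N (σ * τ) := by
  refine fx_opt_some N _ _ (σ y) (by simp) fun a => ?_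
  by_cases h : τ a = y
  · right; simp [h]
  · left; simp [swap_apply_def, h]

lemma fx_conj2 (N : ℕ) (σ τ : Perm β) (y z : β) (hyz : y ≠ z) :
    fx N (optionCongr σ * swap none (some z) * (swap none (some y) * optionCongr τ)
      : Perm (Option β)) = fx N (σ * swap z y * τ) := by
  refine fx_opt_some N _ _ (σ y) (by simp [swap_apply_def, hyz]) fun a => ?_
  by_cases h : τ a = y
  · left; simp [h]
  · by_cases h' : τ a = z
    · right; simp [swap_apply_def, h, h', hyz.symm]
    · left; simp [swap_apply_def, h, h']

lemma card_arm (r c : Option β → ℕ) (hs : IsShape r c)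
    (hr : ∀ y, r (some y) = r none → c (some y) ≤ c none) :
    (univ.filter (fun y : β => r (some y) = r none)).card = c none := by
  rw [← Finset.card_range (c none)]
  refine Finset.card_bij (fun y _ => c (some y)) ?_ ?_ ?_
  · intro y hy
    simp only [mem_filter, mem_univ, true_and, mem_range] at *
    refine lt_of_le_of_ne (hr y hy) fun h => ?_
    simpa using hs.inj _ _ hy h
  · intro y hy z hz h
    simp only [mem_filter, mem_univ, true_and] at *
    simpa using hs.inj _ _ (hy.trans hz.symm) h
  · intro j hj
    rw [mem_range] at hj
    obtain ⟨y, h1, h2⟩ := hs.lower none (r none) j le_rfl hj.le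
    rcases y with _ | y
    · omega
    · exact ⟨y, by simpa using h1, h2⟩

lemma IsShape.symm {α : Type} {r c : α → ℕ} (h : IsShape r c) : IsShape c r :=
  ⟨fun x y h1 h2 => h.inj x y h2 h1, fun x i j h1 h2 => by
    obtain ⟨y, h3, h4⟩ := h.lower x j i h2 h1
    exact ⟨y, h4, h3⟩⟩

lemma Z_option (N : ℕ) (r c : Option β → ℕ) (hs : IsShape r c)
    (hr : ∀ y, r (some y) = r none → c (some y) ≤ c none)
    (hc : ∀ y, c (some y) = c none → r (some y) ≤ r none) :
    Z N r c = (N + c none - r none) * Z N (r ∘ some) (c ∘ some) := by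
  unfold Z
  rw [sum_VS_option']
  simp only [sum_VS_option r]
  have hyz : ∀ y z, r (some y) = r none → c (some z) = c none → y ≠ z := by
    rintro y z h1 h2 rfl
    simpa using hs.inj _ _ h1 h2
  have e1 : ∀ σ τ : Perm β, (optionCongr σ * optionCongr τ : Perm (Option β)) =
      optionCongr (σ * τ) := by
    intro σ τ; ext x; rcases x with _ | x <;> simp
  have e2 : ∀ σ τ : Perm β, ∀ z : β, (optionCongr σ * swap none (some z) * optionCongr τ :
      Perm (Option β)) = (optionCongr σ * (swap none (some z) * optionCongr τ)) := by
    intro σ τ z; rw [mul_assoc]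
  have e3 : ∀ σ : Perm β, ∀ z : β, ((Perm.sign (optionCongr σ * swap none (some z) : Perm (Option β))
    : ℤˣ) : ℤ) = - ((Perm.sign σ : ℤˣ) : ℤ) := by
    intro σ z; rw [Perm.sign_mul, Perm.sign_swap (by simp), optionCongr_sign]; simp
  simp only [e1, e2, e3, fx_opt_none, fx_conj1, optionCongr_sign, Finset.sum_const, card_arm r c hs hr]
  have h0 : ∑ σ ∈ VS (c ∘ some), ∑ z ∈ univ.filter (fun z : β => c (some z) = c none),
     ∑ τ ∈ VS (r ∘ some), ∑ y ∈ univ.filter (fun y : β => r (some y) = r none),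
     ((Perm.sign σ : ℤˣ) : ℤ) *
        (fx N (optionCongr σ * swap none (some z) * (swap none (some y) * optionCongr τ)
      : Perm (Option β)) : ℤ) = 0 := by
    rw [Finset.sum_comm]
    refine Finset.sum_eq_zero fun z hz => ?_
    have : ∀ σ ∈ VS (c ∘ some), (∑ τ ∈ VS (r ∘ some),
      ∑ y ∈ univ.filter (fun y : β => r (some y) = r none),
     ((Perm.sign σ : ℤˣ) : ℤ) *
        (fx N (optionCongr σ * swap none (some z) * (swap none (some y) * optionCongr τ)
      : Perm (Option β)) : ℤ)) = ∑ y ∈ univ.filter (fun y : β => r (some y) = r none),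
        ∑ τ ∈ VS (r ∘ some), ((Perm.sign σ : ℤˣ) : ℤ) * (fx N (σ * swap z y * τ) : ℤ) := by
      intro σ _
      rw [Finset.sum_comm]
      refine Finset.sum_congr rfl fun y hy => Finset.sum_congr rfl fun τ _ => ?_
      simp only [mem_filter, mem_univ, true_and] at hy hz
      rw [fx_conj2 _ _ _ _ _ (hyz y z hy hz)]
    rw [Finset.sum_congr rfl this, Finset.sum_comm]
    refine Finset.sum_eq_zero fun y hy => ?_
    simp only [mem_filter, mem_univ, true_and] at hy hz
    obtain ⟨w, h1, h2⟩ := hs.lower none (r (some z)) (c (some y)) (hc z hz) (hr y hy)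
    have hzr : r (some z) ≠ r none := fun h => by simpa using hs.inj _ _ h hz
    have hyc : c (some y) ≠ c none := fun h => by simpa using hs.inj _ _ hy h
    rcases w with _ | w
    · exact absurd h1.symm hzr
    · refine Z_vanish N _ _ y z w h1 h2 (hyz y z hy hz) ?_ ?_
      · rintro rfl; exact hzr (h1.symm.trans hy)
      · rintro rfl; exact hyc (h2.symm.trans hz)
  have h0' : ∑ σ ∈ VS (c ∘ some), ∑ z ∈ univ.filter (fun z : β => c (some z) = c none),
     ∑ τ ∈ VS (r ∘ some), ∑ y ∈ univ.filter (fun y : β => r (some y) = r none),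
     -((Perm.sign σ : ℤˣ) : ℤ) *
        (fx N (optionCongr σ * swap none (some z) * (swap none (some y) * optionCongr τ)
      : Perm (Option β)) : ℤ) = 0 := by
    simpa only [neg_mul, Finset.sum_neg_distrib, neg_eq_zero] using h0
  simp only [Finset.sum_add_distrib, h0', add_zero, Finset.sum_const, card_arm c r hs.symm hc,
    Finset.mul_sum]
  simp only [← Finset.sum_add_distrib]
  refine Finset.sum_congr rfl fun σ _ => ?_
  rw [Finset.smul_sum, ← Finset.sum_add_distrib]
  refine Finset.sum_congr rfl fun τ _ => ?_
  simp only [nsmul_eq_mul]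
  push_cast
  ring

lemma IsShape.comp_equiv {α γ : Type} {r c : α → ℕ} (h : IsShape r c) (e : γ ≃ α) :
    IsShape (r ∘ e) (c ∘ e) :=
  ⟨fun x y h1 h2 => e.injective (h.inj _ _ h1 h2), fun x i j h1 h2 => by
    obtain ⟨y, h3, h4⟩ := h.lower (e x) i j h1 h2
    exact ⟨e.symm y, by simpa using h3, by simpa using h4⟩⟩

end opt

lemma Z_formula (N n : ℕ) : ∀ (α : Type) [Fintype α] [DecidableEq α] (r c : α → ℕ),
    Fintype.card α = n → IsShape r c → Z N r c = ∏ x, ((N : ℤ) + c x - r x) := by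
  induction n with
  | zero =>
    intro α _ _ r c h hs
    have := Fintype.card_eq_zero_iff.1 h
    have h1 : ∀ r : α → ℕ, VS r = {1} := by
      intro r; ext σ; simp [mem_VS, Subsingleton.elim σ 1]
    simp [Z, h1, fx]
  | succ n ih =>
    intro α _ _ r c h hs
    have hne : Nonempty α := Fintype.card_pos_iff.1 (by omega)
    obtain ⟨x, -, hx⟩ := Finset.exists_max_image (univ : Finset α) (fun x => r x + c x)
      Finset.univ_nonempty
    have e := Equiv.optionSubtypeNe x
    have hx' : ∀ y, r y + c y ≤ r x + c x := fun y => hx y (mem_univ _)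
    rw [Z_equiv N (Equiv.optionSubtypeNe x), Z_option N _ _ (hs.comp_equiv _), ih]
    · rw [← (Equiv.optionSubtypeNe x).prod_comp, Fintype.prod_option]
      simp
    · have := Fintype.card_congr (Equiv.optionSubtypeNe x)
      rw [Fintype.card_option] at this
      omega
    · refine ⟨fun y z h1 h2 => ?_, fun y i j h1 h2 => ?_⟩
      · exact Subtype.ext (hs.inj _ _ h1 h2)
      · obtain ⟨z, h3, h4⟩ := hs.lower y i j h1 h2
        by_cases hz : z = x
        · subst hz
          simp only [Function.comp_apply, Equiv.optionSubtypeNe_some] at h1 h2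
          have := hx' y
          exact absurd (hs.inj y z (by omega) (by omega)) y.2
        · exact ⟨⟨z, hz⟩, by simpa using h3, by simpa using h4⟩
    · intro y hy
      have := hx' y
      simp only [Function.comp_apply, Equiv.optionSubtypeNe_some, Equiv.optionSubtypeNe_none] at *
      omega
    · intro y hy
      have := hx' y
      simp only [Function.comp_apply, Equiv.optionSubtypeNe_some, Equiv.optionSubtypeNe_none] at *
      omega

lemma sum_range_add_le (s : Finset ℕ) :
    ∑ i ∈ range s.card, i + (range s.card \ s).card ≤ ∑ i ∈ s, i := by
  have h1 := Finset.sum_inter_add_sum_sdiff (range s.card) s (fun i => i)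
  have h2 := Finset.sum_inter_add_sum_sdiff s (range s.card) (fun i => i)
  have h3 : (range s.card \ s).card = (s \ range s.card).card := by
    have e1 := Finset.card_sdiff_add_card_inter (range s.card) s
    have e2 := Finset.card_sdiff_add_card_inter s (range s.card)
    rw [Finset.inter_comm, Finset.card_range] at e1
    omega
  have h4 : ∑ i ∈ range s.card \ s, (i + 1) ≤ (range s.card \ s).card * s.card := by
    refine Finset.sum_le_card_nsmul _ _ _ fun i hi => ?_
    simp only [mem_sdiff, mem_range] at hi
    omega
  have h5 : (s \ range s.card).card * s.card ≤ ∑ i ∈ s \ range s.card, i := by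
    refine Finset.card_nsmul_le_sum _ _ _ fun i hi => ?_
    simp only [mem_sdiff, mem_range] at hi
    omega
  rw [Finset.sum_add_distrib] at h4
  rw [Finset.inter_comm] at h1
  rw [h3] at h4
  simp only [sum_const, smul_eq_mul, mul_one] at h4
  omega

lemma lower_eq_range (s : Finset ℕ) (h : ∀ x ∈ s, ∀ i ≤ x, i ∈ s) : s = range s.card := by
  refine Finset.eq_of_subset_of_card_le ?_ (by simp)
  intro x hx
  have : range (x + 1) ⊆ s := fun i hi => h x hx i (by simpa [Nat.lt_succ_iff] using hi)
  have := Finset.card_le_card this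
  simpa using this

section
variable {α : Type} [Fintype α] [DecidableEq α]

lemma exists_col_perm (r c ρ : α → ℕ) (hs : IsShape r c)
    (hsum : ∑ x, ρ x = ∑ x, r x) (hinj : ∀ x y, c x = c y → ρ x = ρ y → x = y) :
    ∃ v ∈ VS c, ∀ x, r (v x) = ρ x := by
  have hcol : ∀ j, ∑ x ∈ univ.filter (fun x => c x = j), r x +
      (range (univ.filter (fun x => c x = j)).card \
        (univ.filter (fun x => c x = j)).image ρ).card ≤
      ∑ x ∈ univ.filter (fun x => c x = j), ρ x ∧
      (univ.filter (fun x => c x = j)).image r = range (univ.filter (fun x => c x = j)).card := by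
    intro j
    set C := univ.filter (fun x => c x = j) with hC
    have hr : Set.InjOn r C := by
      intro x hx y hy h
      simp only [hC, coe_filter, mem_univ, true_and, Set.mem_ofPred_eq] at hx hy
      exact hs.inj _ _ h (hx.trans hy.symm)
    have hρ : Set.InjOn ρ C := by
      intro x hx y hy h
      simp only [hC, coe_filter, mem_univ, true_and, Set.mem_ofPred_eq] at hx hy
      exact hinj _ _ (hx.trans hy.symm) h
    have h1 : C.image r = range C.card := by
      have := lower_eq_range (C.image r) (by
        intro x hx i hi
        simp only [hC, mem_image, mem_filter, mem_univ, true_and] at *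
        obtain ⟨y, hy, rfl⟩ := hx
        obtain ⟨z, h1, h2⟩ := hs.lower y i (c y) hi le_rfl
        exact ⟨z, h2.trans hy, h1⟩)
      rwa [Finset.card_image_of_injOn hr] at this
    refine ⟨?_, h1⟩
    have h2 := sum_range_add_le (C.image ρ)
    rw [Finset.card_image_of_injOn hρ, Finset.sum_image hρ, ← h1, Finset.sum_image hr] at h2
    rwa [h1] at h2
  have hm : ∀ x ∈ (univ : Finset α), c x ∈ univ.image c := fun x _ => mem_image_of_mem _ (mem_univ _)
  rw [← Finset.sum_fiberwise_of_maps_to hm, ← Finset.sum_fiberwise_of_maps_to hm] at hsum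
  have heq := (Finset.sum_eq_sum_iff_of_le (s := univ.image c)
    (f := fun j => ∑ x ∈ univ.filter (fun x => c x = j), r x)
    (g := fun j => ∑ x ∈ univ.filter (fun x => c x = j), ρ x)
    (fun j _ => by have := (hcol j).1; omega)).1 hsum.symm
  have hex : ∀ x, ∃ y, c y = c x ∧ r y = ρ x := by
    intro x
    obtain ⟨h1, h2⟩ := hcol (c x)
    have h3 := heq (c x) (hm x (mem_univ _))
    have h4 : (range (univ.filter (fun y => c y = c x)).card \
        (univ.filter (fun y => c y = c x)).image ρ).card = 0 := by omega
    have h5 : (univ.filter (fun y => c y = c x)).image ρ =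
        range (univ.filter (fun y => c y = c x)).card := by
      rw [Finset.card_eq_zero, Finset.sdiff_eq_empty_iff_subset] at h4
      refine (Finset.eq_of_subset_of_card_le h4 ?_).symm
      rw [card_range]; exact card_image_le
    rw [← h2] at h5
    have h6 : ρ x ∈ (univ.filter (fun y => c y = c x)).image ρ :=
      mem_image_of_mem _ (by simp)
    rw [h5] at h6
    simpa using h6
  choose v hv1 hv2 using hex
  have hvi : Function.Injective v := by
    intro x y h
    exact hinj x y (by rw [← hv1, h, hv1]) (by rw [← hv2, h, hv2])
  refine ⟨Equiv.ofBijective v (Finite.injective_iff_bijective.1 hvi), ?_, ?_⟩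
  · rw [mem_VS]; simpa using hv1
  · simpa using hv2

variable (k : Type*) [Field k]

/-- column antisymmetrizer -/
noncomputable def bE (c : α → ℕ) : MonoidAlgebra k (Perm α) :=
  ∑ v ∈ VS c, MonoidAlgebra.single v (((Perm.sign v : ℤˣ) : ℤ) : k)

/-- row symmetrizer -/
noncomputable def aE (r : α → ℕ) : MonoidAlgebra k (Perm α) :=
  ∑ h ∈ VS r, MonoidAlgebra.single h (1 : k)

lemma bE_mul (c : α → ℕ) {t : Perm α} (ht : t ∈ VS c) :
    bE k c * MonoidAlgebra.single t 1 = (((Perm.sign t : ℤˣ) : ℤ) : k) • bE k c := by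
  unfold bE
  conv_rhs => rw [sum_VS_mul_right c _ ht]
  rw [Finset.sum_mul, Finset.smul_sum]
  refine Finset.sum_congr rfl fun v _ => ?_
  rw [MonoidAlgebra.single_mul_single, MonoidAlgebra.smul_single, mul_one]
  congr 1
  rcases Int.units_eq_one_or (Perm.sign t) with h | h <;> simp [h]

lemma mul_aE (r : α → ℕ) {t : Perm α} (ht : t ∈ VS r) :
    MonoidAlgebra.single t 1 * aE k r = aE k r := by
  unfold aE
  conv_rhs => rw [sum_VS_mul_left r _ ht]
  rw [Finset.mul_sum]
  refine Finset.sum_congr rfl fun v _ => ?_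
  rw [MonoidAlgebra.single_mul_single, mul_one]

lemma von_neumann [CharZero k] (r c : α → ℕ) (hs : IsShape r c) (g : Perm α) :
    ∃ s : k, bE k c * MonoidAlgebra.single g 1 * aE k r = s • (bE k c * aE k r) := by
  by_cases hinj : ∀ x y, c x = c y → r (g⁻¹ x) = r (g⁻¹ y) → x = y
  · obtain ⟨v, hv, hv2⟩ := exists_col_perm r c (r ∘ ⇑g⁻¹) hs
      (by simpa using Equiv.sum_comp g⁻¹ r) hinj
    have hh : v * g ∈ VS r := by
      rw [mem_VS]; intro x; simp [hv2]
    have e : (MonoidAlgebra.single g 1 : MonoidAlgebra k (Perm α)) =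
        MonoidAlgebra.single v⁻¹ 1 * MonoidAlgebra.single (v * g) 1 := by
      rw [MonoidAlgebra.single_mul_single]; simp
    refine ⟨(((Perm.sign v⁻¹ : ℤˣ) : ℤ) : k), ?_⟩
    rw [e, ← mul_assoc, bE_mul k c (inv_VS hv), mul_assoc, mul_aE k r hh, smul_mul_assoc]
  · push Not at hinj
    obtain ⟨x, y, h1, h2, h3⟩ := hinj
    refine ⟨0, ?_⟩
    have ht : swap x y ∈ VS c := swap_VS h1
    have ht' : swap (g⁻¹ x) (g⁻¹ y) ∈ VS r := swap_VS h2
    have e : (MonoidAlgebra.single (swap x y) 1 * MonoidAlgebra.single g 1 :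
        MonoidAlgebra k (Perm α)) =
        MonoidAlgebra.single g 1 * MonoidAlgebra.single (swap (g⁻¹ x) (g⁻¹ y)) 1 := by
      rw [MonoidAlgebra.single_mul_single, MonoidAlgebra.single_mul_single, mul_swap_eq_swap_mul]
      simp
    have key : bE k c * MonoidAlgebra.single g 1 * aE k r =
        - (bE k c * MonoidAlgebra.single g 1 * aE k r) := by
      conv_lhs => rw [← mul_aE k r ht', ← mul_assoc, mul_assoc (bE k c), ← e, ← mul_assoc,
        bE_mul k c ht, Perm.sign_swap h3]
      simp
    rw [zero_smul]
    have h2 : (2 : k) • (bE k c * MonoidAlgebra.single g 1 * aE k r) = 0 := by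
      rw [two_smul]; exact eq_neg_iff_add_eq_zero.1 key
    exact (smul_eq_zero.1 h2).resolve_left two_ne_zero

lemma exists_scalar [CharZero k] (r c : α → ℕ) (hs : IsShape r c) :
    ∃ m : k, (bE k c * aE k r) * (bE k c * aE k r) = m • (bE k c * aE k r) := by
  have key : ∀ x : MonoidAlgebra k (Perm α), ∃ s : k, bE k c * x * aE k r = s • (bE k c * aE k r) := by
    intro x
    induction x using MonoidAlgebra.induction_on with
    | of g => exact von_neumann k r c hs g
    | add x y hx hy =>
      obtain ⟨s, hs⟩ := hx
      obtain ⟨t, ht⟩ := hy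
      exact ⟨s + t, by rw [mul_add, add_mul, hs, ht, add_smul]⟩
    | smul a x hx =>
      obtain ⟨s, hs⟩ := hx
      exact ⟨a * s, by rw [mul_smul_comm, smul_mul_assoc, hs, mul_smul]⟩
  obtain ⟨m, hm⟩ := key (aE k r * bE k c)
  exact ⟨m, by rw [← hm]; simp only [mul_assoc]⟩

end

section
variable {α : Type} [Fintype α] [DecidableEq α]
variable (k : Type*) [Field k]

/-- permutation matrices on tensor space -/
def permMat (N : ℕ) : Perm α →* Matrix (α → Fin N) (α → Fin N) k where
  toFun g := Matrix.of fun f f' => if f ∘ g = f' then 1 else 0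
  map_one' := by
    ext f f'
    simp [Matrix.one_apply]
  map_mul' g h := by
    ext f f'
    simp only [Matrix.mul_apply, Matrix.of_apply, Perm.coe_mul, ite_mul, one_mul, zero_mul,
      Finset.sum_ite_eq, mem_univ, if_true]
    rfl

lemma permMat_trace (N : ℕ) (g : Perm α) : (permMat k N g).trace = (fx N g : k) := by
  simp [permMat, Matrix.trace, fx]

lemma permMat_transpose (N : ℕ) (g : Perm α) : (permMat k N g).transpose = permMat k N g⁻¹ := by
  ext f f'
  simp only [permMat, Matrix.transpose_apply, MonoidHom.coe_mk, OneHom.coe_mk, Matrix.of_apply]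
  refine if_congr ?_ rfl rfl
  constructor
  · rintro rfl; funext x; simp
  · rintro rfl; funext x; simp

lemma permMat_mulVec (N : ℕ) (g : Perm α) (w : (α → Fin N) → k) (f : α → Fin N) :
    (permMat k N g).mulVec w f = w (f ∘ g) := by
  simp [permMat, Matrix.mulVec, dotProduct]

/-- column antisymmetrizer matrix -/
def bM (N : ℕ) (c : α → ℕ) : Matrix (α → Fin N) (α → Fin N) k :=
  ∑ v ∈ VS c, (((Perm.sign v : ℤˣ) : ℤ) : k) • permMat k N v

/-- row symmetrizer matrix -/
def aM (N : ℕ) (r : α → ℕ) : Matrix (α → Fin N) (α → Fin N) k :=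
  ∑ v ∈ VS r, permMat k N v

lemma lift_bE (N : ℕ) (c : α → ℕ) : MonoidAlgebra.lift k _ _ (permMat k N) (bE k c) = bM k N c := by
  simp [bE, bM]

lemma lift_aE (N : ℕ) (c : α → ℕ) : MonoidAlgebra.lift k _ _ (permMat k N) (aE k c) = aM k N c := by
  simp [aE, aM]

lemma bM_transpose (N : ℕ) (c : α → ℕ) : (bM k N c).transpose = bM k N c := by
  unfold bM
  rw [Matrix.transpose_sum, sum_VS_inv]
  simp [permMat_transpose]

lemma aM_transpose (N : ℕ) (c : α → ℕ) : (aM k N c).transpose = aM k N c := by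
  unfold aM
  rw [Matrix.transpose_sum, sum_VS_inv]
  simp [permMat_transpose]

lemma trace_bM_aM (N : ℕ) (r c : α → ℕ) : (bM k N c * aM k N r).trace = ((Z N r c : ℤ) : k) := by
  unfold bM aM Z
  rw [Finset.sum_mul, Matrix.trace_sum]
  push_cast
  refine Finset.sum_congr rfl fun v _ => ?_
  rw [Finset.mul_sum, Matrix.trace_sum]
  refine Finset.sum_congr rfl fun h _ => ?_
  rw [smul_mul_assoc, ← map_mul, Matrix.trace_smul, permMat_trace, smul_eq_mul]

lemma trace_eq_rank [CharZero k] {ι : Type*} [Fintype ι] [DecidableEq ι] (M : Matrix ι ι k) (m : k)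
    (h : M * M = m • M) (ht : M.trace ≠ 0) : M.trace = m * M.rank ∧ m ≠ 0 := by
  have hm : m ≠ 0 := by
    rintro rfl
    rw [zero_smul] at h
    have := Matrix.isNilpotent_trace_of_isNilpotent (M := M) ⟨2, by rw [pow_two, h]⟩
    exact ht this.eq_zero
  refine ⟨?_, hm⟩
  set P := m⁻¹ • M with hP
  have hPP : P * P = P := by
    rw [hP, smul_mul_smul_comm, h, smul_smul]
    congr 1
    field_simp
  have h1 : P.trace = P.rank := by
    have hid : IsIdempotentElem (Matrix.toLin' P) := by
      rw [IsIdempotentElem, Module.End.mul_eq_comp, ← Matrix.toLin'_mul, hPP]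
    have := (LinearMap.IsIdempotentElem.isProj_range _ hid).trace
    rw [Matrix.trace_toLin'_eq] at this
    rw [this]
    rfl
  have h2 : P.rank = M.rank := by
    rw [hP]
    exact Matrix.rank_smul_of_mem_nonZeroDivisors _ (mem_nonZeroDivisors_of_ne_zero (inv_ne_zero hm))
  rw [← h2, ← h1, hP, Matrix.trace_smul, smul_eq_mul, mul_inv_cancel_left₀ hm]

lemma scalar_rank [CharZero k] (N : ℕ) (r c : α → ℕ) (hs : IsShape r c) (hN : ∀ x, r x < N) (m : k)
    (hm : (bE k c * aE k r) * (bE k c * aE k r) = m • (bE k c * aE k r)) :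
    ((∏ x, ((N : ℤ) + c x - r x) : ℤ) : k) = m * (aM k N r * bM k N c).rank ∧
     ((∏ x, ((N : ℤ) + c x - r x) : ℤ) : k) ≠ 0 := by
  have h := congrArg (MonoidAlgebra.lift k _ _ (permMat k N)) hm
  rw [map_smul, map_mul, map_mul, lift_bE, lift_aE] at h
  have hne : ((∏ x, ((N : ℤ) + c x - r x) : ℤ) : k) ≠ 0 := by
    rw [Int.cast_ne_zero, Finset.prod_ne_zero_iff]
    intro x _
    have := hN x
    omega
  have ht := trace_bM_aM k N r c
  rw [Z_formula N _ α r c rfl hs] at ht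
  have h2 := (trace_eq_rank k _ m h (by rw [ht]; exact hne)).1
  rw [ht, ← Matrix.rank_transpose, Matrix.transpose_mul, bM_transpose, aM_transpose] at h2
  exact ⟨h2, hne⟩

end

section
variable {α : Type} [Fintype α] [DecidableEq α]
variable (k : Type*) [Field k]

/-- symmetrization to polynomials -/
noncomputable def SS (N : ℕ) (r : α → ℕ) : ((α → Fin N) → k) →ₗ[k] MvPolynomial (ℕ × Fin N) k :=
  Fintype.linearCombination k (fun f : α → Fin N => ∏ x, MvPolynomial.X (r x, f x))

/-- products of minors -/
noncomputable def PP (N : ℕ) (r c : α → ℕ) (f : α → Fin N) : MvPolynomial (ℕ × Fin N) k :=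
  ∑ v ∈ VS c, (((Perm.sign v : ℤˣ) : ℤ) : k) • ∏ x, MvPolynomial.X (r (v x), f x)

lemma SS_perm (N : ℕ) (r : α → ℕ) (g : Perm α) (w : (α → Fin N) → k) :
    SS k N r ((permMat k N g).mulVec w) =
      ∑ f : α → Fin N, w f • ∏ x, MvPolynomial.X (r (g x), f x) := by
  rw [SS, Fintype.linearCombination_apply]
  rw [← (Equiv.arrowCongr g (Equiv.refl (Fin N))).sum_comp]
  refine Finset.sum_congr rfl fun f _ => ?_
  rw [permMat_mulVec]
  congr 1
  · congr 1; funext x; simp [Equiv.arrowCongr]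
  · rw [← Equiv.prod_comp g]
    simp [Equiv.arrowCongr]

lemma SS_bM (N : ℕ) (r c : α → ℕ) :
    SS k N r ∘ₗ (bM k N c).mulVecLin = Fintype.linearCombination k (PP k N r c) := by
  refine LinearMap.ext fun w => ?_
  rw [LinearMap.comp_apply, Matrix.mulVecLin_apply, bM, Matrix.sum_mulVec, map_sum,
    Fintype.linearCombination_apply]
  simp only [Matrix.smul_mulVec, map_smul, SS_perm, PP, Finset.smul_sum]
  rw [Finset.sum_comm]
  refine Finset.sum_congr rfl fun f _ => Finset.sum_congr rfl fun v _ => ?_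
  rw [smul_comm]

lemma SS_aM (N : ℕ) (r : α → ℕ) (w : (α → Fin N) → k) :
    SS k N r ((aM k N r).mulVec w) = ((VS r).card : k) • SS k N r w := by
  rw [aM, Matrix.sum_mulVec, map_sum, Nat.cast_smul_eq_nsmul]
  refine Finset.sum_eq_card_nsmul fun h hh => ?_
  rw [SS_perm, SS, Fintype.linearCombination_apply]
  refine Finset.sum_congr rfl fun f _ => ?_
  simp only [mem_VS.1 hh]

lemma aM_inv (N : ℕ) (r : α → ℕ) (w : (α → Fin N) → k) (h : Perm α) (hh : h ∈ VS r)
    (f : α → Fin N) :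
    (aM k N r).mulVec w (f ∘ h) = (aM k N r).mulVec w f := by
  have : ∀ f, (aM k N r).mulVec w f = ∑ g ∈ VS r, w (f ∘ g) := by
    intro f
    rw [aM, Matrix.sum_mulVec, Finset.sum_apply]
    simp only [permMat_mulVec]
  rw [this, this, sum_VS_mul_left r (fun g => w (f ∘ g)) hh]
  rfl

lemma mono_eq (N : ℕ) (r : α → ℕ) (f f' : α → Fin N)
    (h : (∑ x, Finsupp.single (r x, f x) 1 : (ℕ × Fin N) →₀ ℕ) =
      ∑ x, Finsupp.single (r x, f' x) 1) : ∃ g ∈ VS r, f' = f ∘ g := by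
  have hc : ∀ p : ℕ × Fin N, Fintype.card {x // (r x, f' x) = p} =
      Fintype.card {x // (r x, f x) = p} := by
    intro p
    have := DFunLike.congr_fun h p
    simp only [Finsupp.coe_finsetSum, Finset.sum_apply, Finsupp.single_apply, Finset.sum_boole] at this
    rw [Fintype.card_subtype, Fintype.card_subtype]
    simpa using this.symm
  let e : Perm α := Equiv.ofFiberEquiv (f := fun x => (r x, f' x)) (g := fun x => (r x, f x))
    (fun p => Fintype.equivOfCardEq (hc p))
  have he : ∀ x, (r (e x), f (e x)) = (r x, f' x) := fun x =>
    Equiv.ofFiberEquiv_map (f := fun x => (r x, f' x)) (g := fun x => (r x, f x)) _ x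
  refine ⟨e, mem_VS.2 fun x => (Prod.ext_iff.1 (he x)).1, funext fun x => (Prod.ext_iff.1 (he x)).2.symm⟩

lemma ker_eq [CharZero k] (N : ℕ) (r : α → ℕ) :
    LinearMap.ker (aM k N r).mulVecLin = LinearMap.ker (SS k N r) := by
  have hcard : ((VS r).card : k) ≠ 0 := by
    rw [Nat.cast_ne_zero]
    exact (Finset.card_pos.2 ⟨1, one_VS r⟩).ne'
  ext w
  rw [LinearMap.mem_ker, LinearMap.mem_ker, Matrix.mulVecLin_apply]
  constructor
  · intro h
    have h2 := SS_aM k N r w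
    rw [h, map_zero] at h2
    exact (smul_eq_zero.1 h2.symm).resolve_left hcard
  · intro h
    have h2 := SS_aM k N r w
    rw [h, smul_zero] at h2
    set u := (aM k N r).mulVec w with hu
    funext f
    have h3 := congrArg (MvPolynomial.coeff (∑ x, Finsupp.single (r x, f x) 1)) h2
    have hX : ∀ f : α → Fin N, (∏ x, MvPolynomial.X (r x, f x) : MvPolynomial (ℕ × Fin N) k) =
        MvPolynomial.monomial (∑ x, Finsupp.single (r x, f x) 1) 1 := by
      intro f
      rw [MvPolynomial.monomial_sum_one]
      rfl
    rw [SS, Fintype.linearCombination_apply, MvPolynomial.coeff_sum, MvPolynomial.coeff_zero] at h3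
    simp only [hX, MvPolynomial.coeff_smul, MvPolynomial.coeff_monomial, smul_eq_mul, mul_ite, mul_one,
      mul_zero, ← Finset.sum_filter] at h3
    have h4 : ∀ f' ∈ univ.filter (fun f' : α → Fin N =>
        (∑ x, Finsupp.single (r x, f' x) 1 : (ℕ × Fin N) →₀ ℕ) =
      ∑ x, Finsupp.single (r x, f x) 1), u f' = u f := by
      intro f' hf'
      simp only [mem_filter, mem_univ, true_and] at hf'
      obtain ⟨g, hg, rfl⟩ := mono_eq N r f f' hf'.symm
      exact aM_inv k N r w g hg f
    rw [Finset.sum_congr rfl h4, Finset.sum_const, nsmul_eq_mul, mul_eq_zero] at h3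
    refine h3.resolve_left ?_
    rw [Nat.cast_eq_zero]
    exact (Finset.card_pos.2 ⟨f, by simp⟩).ne'

lemma rank_eq [CharZero k] (N : ℕ) (r c : α → ℕ) :
    (aM k N r * bM k N c).rank =
      Module.finrank k (Submodule.span k (Set.range (PP k N r c))) := by
  rw [← Fintype.range_linearCombination, ← SS_bM, Matrix.rank, Matrix.mulVecLin_mul]
  have h1 := LinearMap.finrank_range_add_finrank_ker ((aM k N r).mulVecLin ∘ₗ (bM k N c).mulVecLin)
  have h2 := LinearMap.finrank_range_add_finrank_ker (SS k N r ∘ₗ (bM k N c).mulVecLin)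
  have h3 : LinearMap.ker ((aM k N r).mulVecLin ∘ₗ (bM k N c).mulVecLin) =
      LinearMap.ker (SS k N r ∘ₗ (bM k N c).mulVecLin) := by
    rw [LinearMap.ker_comp, LinearMap.ker_comp, ker_eq]
  rw [h3] at h1
  omega

end

section col
variable {β : Type} [Fintype β] [DecidableEq β]
variable (k : Type*) [Field k]

lemma sum_VS_sum {M : Type*} [AddCommMonoid M] (l : ℕ) (c : Fin l ⊕ β → ℕ)
    (h0 : ∀ i, c (Sum.inl i) = 0) (h1 : ∀ y, c (Sum.inr y) ≠ 0) (F : Perm (Fin l ⊕ β) → M) :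
    ∑ v ∈ VS c, F v = ∑ σ : Perm (Fin l), ∑ τ ∈ VS (c ∘ Sum.inr), F (Perm.sumCongr σ τ) := by
  rw [← Finset.sum_product']
  symm
  refine Finset.sum_bij (fun p _ => Perm.sumCongr p.1 p.2) ?_ ?_ ?_ ?_
  · rintro ⟨σ, τ⟩ h
    simp only [mem_product, mem_univ, true_and, mem_VS] at *
    rintro (x | x)
    · simp [h0]
    · simpa using h x
  · rintro ⟨σ, τ⟩ _ ⟨σ', τ'⟩ _ h
    have := Perm.sumCongrHom_injective (a₁ := (σ, τ)) (a₂ := (σ', τ')) h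
    exact this
  · intro v hv
    rw [mem_VS] at hv
    have hm : v ∈ (Perm.sumCongrHom (Fin l) β).range := by
      refine Perm.mem_sumCongrHom_range_of_perm_mapsTo_inl ?_
      rintro _ ⟨i, rfl⟩
      have := hv (Sum.inl i)
      rw [h0] at this
      rcases hx : v (Sum.inl i) with j | y
      · exact ⟨j, rfl⟩
      · rw [hx] at this
        exact absurd this (h1 y)
    obtain ⟨⟨σ, τ⟩, rfl⟩ := hm
    refine ⟨(σ, τ), ?_, rfl⟩
    simp only [mem_product, mem_univ, true_and, mem_VS]
    intro x
    simpa using hv (Sum.inr x)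
  · intro p _; rfl

/-- generic matrix -/
noncomputable def XM (l : ℕ) : Matrix (Fin l) (Fin l) (MvPolynomial (ℕ × Fin l) k) :=
  Matrix.of fun i j => MvPolynomial.X ((i : ℕ), j)

lemma XM_det (l : ℕ) : (XM k l).det ≠ 0 := by
  intro h
  have h2 := congrArg (MvPolynomial.eval (fun p : ℕ × Fin l => if p.1 = (p.2 : ℕ) then (1 : k) else 0)) h
  rw [RingHom.map_det, map_zero] at h2
  have : (MvPolynomial.eval (fun p : ℕ × Fin l => if p.1 = (p.2 : ℕ) then (1 : k) else 0)).mapMatrix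
      (XM k l) = 1 := by
    ext i j
    simp [XM, Matrix.one_apply, Fin.ext_iff]
  rw [this, Matrix.det_one] at h2
  exact one_ne_zero h2

lemma PP_sum (l : ℕ) (r c : Fin l ⊕ β → ℕ) (hr : ∀ i, r (Sum.inl i) = i)
    (h0 : ∀ i, c (Sum.inl i) = 0) (h1 : ∀ y, c (Sum.inr y) ≠ 0) (f : Fin l ⊕ β → Fin l) :
    PP k l r c f = (Matrix.of fun j i : Fin l => if j = f (Sum.inl i) then (1 : k) else 0).det •
      ((XM k l).det * PP k l (r ∘ Sum.inr) (c ∘ Sum.inr) (f ∘ Sum.inr)) := by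
  have hdet : (Matrix.of fun p i : Fin l =>
      (MvPolynomial.X ((p : ℕ), f (Sum.inl i)) : MvPolynomial (ℕ × Fin l) k)).det =
      (Matrix.of fun j i : Fin l => if j = f (Sum.inl i) then (1 : k) else 0).det • (XM k l).det := by
    have : (Matrix.of fun p i : Fin l =>
      (MvPolynomial.X ((p : ℕ), f (Sum.inl i)) : MvPolynomial (ℕ × Fin l) k)) =
      XM k l * (MvPolynomial.C (σ := ℕ × Fin l)).mapMatrix
        (Matrix.of fun j i : Fin l => if j = f (Sum.inl i) then (1 : k) else 0) := by
      ext1 p i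
      simp [XM, Matrix.mul_apply, apply_ite MvPolynomial.C]
    rw [this, Matrix.det_mul, ← RingHom.map_det, mul_comm, MvPolynomial.C_mul']
  rw [← smul_mul_assoc, ← hdet, Matrix.det_apply, PP, sum_VS_sum l c h0 h1, Finset.sum_mul]
  refine Finset.sum_congr rfl fun σ _ => ?_
  rw [PP, Finset.mul_sum]
  refine Finset.sum_congr rfl fun τ _ => ?_
  rw [Fintype.prod_sum_type, Perm.sign_sumCongr]
  have hs : ∀ (u : ℤˣ) (p : MvPolynomial (ℕ × Fin l) k), u • p = ((u : ℤ) : k) • p := by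
    intro u p
    rcases Int.units_eq_one_or u with h | h <;> simp [h]
  rw [hs, smul_mul_smul_comm]
  simp [hr]

lemma span_sum (l : ℕ) (r c : Fin l ⊕ β → ℕ) (hr : ∀ i, r (Sum.inl i) = i)
    (h0 : ∀ i, c (Sum.inl i) = 0) (h1 : ∀ y, c (Sum.inr y) ≠ 0) :
    Module.finrank k (Submodule.span k (Set.range (PP k l r c))) =
    Module.finrank k (Submodule.span k (Set.range (PP k l (r ∘ Sum.inr) (c ∘ Sum.inr)))) := by
  have hspan : Submodule.span k (Set.range (PP k l r c)) =
      (Submodule.span k (Set.range (PP k l (r ∘ Sum.inr) (c ∘ Sum.inr)))).map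
        (LinearMap.mulLeft k (XM k l).det) := by
    apply le_antisymm
    · rw [Submodule.span_le]
      rintro _ ⟨f, rfl⟩
      rw [PP_sum k l r c hr h0 h1]
      refine Submodule.smul_mem _ _ ?_
      exact ⟨_, Submodule.subset_span ⟨_, rfl⟩, rfl⟩
    · rw [Submodule.map_span, Submodule.span_le]
      rintro _ ⟨_, ⟨f, rfl⟩, rfl⟩
      refine Submodule.subset_span ⟨Sum.elim id f, ?_⟩
      rw [PP_sum k l r c hr h0 h1]
      have : (Matrix.of fun j i : Fin l => if j = (Sum.elim id f : Fin l ⊕ β → Fin l) (Sum.inl i)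
        then (1 : k) else 0) = 1 := by
        ext i j; by_cases hij : i = j <;> simp [Matrix.one_apply, hij]
      rw [this, Matrix.det_one, one_smul]
      rfl
  rw [hspan]
  refine (Submodule.equivMapOfInjective _ ?_ _).finrank_eq.symm
  intro p q h
  exact mul_left_cancel₀ (XM_det k l) h

end col

section
variable {α : Type} [Fintype α] [DecidableEq α]
variable (k : Type*) [Field k]

/-- hook length -/
def hk (r c : α → ℕ) (x : α) : ℕ :=
  (univ.filter (fun y => r y = r x ∧ c x < c y)).card +
  (univ.filter (fun y => c y = c x ∧ r x < r y)).card + 1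

lemma PP_equiv {γ : Type} [Fintype γ] [DecidableEq γ] (e : γ ≃ α) (N : ℕ) (r c : α → ℕ)
    (f : α → Fin N) : PP k N r c f = PP k N (r ∘ e) (c ∘ e) (f ∘ e) := by
  unfold PP
  rw [sum_VS_equiv e]
  refine Finset.sum_congr rfl fun v _ => ?_
  rw [Perm.sign_permCongr, ← Equiv.prod_comp e]
  simp [Equiv.permCongr_apply]

lemma range_PP_equiv {γ : Type} [Fintype γ] [DecidableEq γ] (e : γ ≃ α) (N : ℕ) (r c : α → ℕ) :
    Set.range (PP k N r c) = Set.range (PP k N (r ∘ e) (c ∘ e)) := by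
  ext p
  constructor
  · rintro ⟨f, rfl⟩
    exact ⟨f ∘ e, (PP_equiv k e N r c f).symm⟩
  · rintro ⟨f, rfl⟩
    refine ⟨f ∘ e.symm, ?_⟩
    rw [PP_equiv k e N r c, Function.comp_assoc, Equiv.symm_comp_self, Function.comp_id]

lemma card_sub (c : α → ℕ) (P : α → Prop) [DecidablePred P] (h : ∀ x, P x → ¬ c x = 0) :
    (univ.filter P).card = (univ.filter (fun y : {x // ¬ c x = 0} => P y.1)).card := by
  symm
  refine Finset.card_bij (fun y _ => y.1) ?_ ?_ ?_
  · intro y hy; simpa using hy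
  · intro y _ z _ h; exact Subtype.ext h
  · intro x hx
    have hx' : P x := by simpa using hx
    exact ⟨⟨x, h x hx'⟩, by simpa using hx', rfl⟩

lemma hk_sub (r c : α → ℕ) (y : {x // ¬ c x = 0}) :
    hk r c y.1 = hk (fun z : {x // ¬ c x = 0} => r z.1) (fun z : {x // ¬ c x = 0} => c z.1 - 1) y := by
  unfold hk
  have hy := y.2
  rw [card_sub c _ (fun x (hx : r x = r y.1 ∧ c y.1 < c x) => by omega),
    card_sub c _ (fun x (hx : c x = c y.1 ∧ r y.1 < r x) => by omega)]
  congr 3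
  · ext z
    have hz := z.2
    simp only [mem_filter, mem_univ, true_and]
    omega
  · ext z
    have hz := z.2
    simp only [mem_filter, mem_univ, true_and]
    omega

lemma shape_sub (r c : α → ℕ) (hs : IsShape r c) :
    IsShape (fun z : {x // ¬ c x = 0} => r z.1) (fun z : {x // ¬ c x = 0} => c z.1 - 1) := by
  refine ⟨fun x y h1 h2 => ?_, fun x i j h1 h2 => ?_⟩
  · have hx := x.2
    have hy := y.2
    exact Subtype.ext (hs.inj _ _ h1 (by omega))
  · have hx := x.2
    obtain ⟨y, h3, h4⟩ := hs.lower x.1 i (j + 1) h1 (by omega)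
    exact ⟨⟨y, by omega⟩, h3, by simp [h4]⟩

lemma exists_first_col (r c : α → ℕ) (hs : IsShape r c) :
    ∃ (l : ℕ) (e : Fin l ⊕ {x // ¬ c x = 0} ≃ α), (∀ i, r (e (Sum.inl i)) = i) ∧
      (∀ i, c (e (Sum.inl i)) = 0) ∧ (∀ y, e (Sum.inr y) = y.1) ∧ ∀ x, r x < l := by
  set C := univ.filter (fun x => c x = 0) with hC
  have hmem : ∀ x, x ∈ C ↔ c x = 0 := by simp [hC]
  have hr : Set.InjOn r C := by
    intro x hx y hy h
    rw [mem_coe, hmem] at hx hy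
    exact hs.inj _ _ h (hx.trans hy.symm)
  have h1 : C.image r = range C.card := by
    have := lower_eq_range (C.image r) (by
      intro x hx i hi
      simp only [mem_image, hmem] at *
      obtain ⟨y, hy, rfl⟩ := hx
      obtain ⟨z, h1, h2⟩ := hs.lower y i (c y) hi le_rfl
      exact ⟨z, h2.trans hy, h1⟩)
    rwa [Finset.card_image_of_injOn hr] at this
  have hlt0 : ∀ x, c x = 0 → r x < C.card := by
    intro x hx
    rw [← mem_range, ← h1]
    exact mem_image_of_mem _ ((hmem x).2 hx)
  have hlt : ∀ x, r x < C.card := by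
    intro x
    obtain ⟨y, h2, h3⟩ := hs.lower x (r x) 0 le_rfl (Nat.zero_le _)
    rw [← h2]
    exact hlt0 y h3
  let φ : {x // c x = 0} → Fin C.card := fun x => ⟨r x.1, hlt x.1⟩
  have hφ : Function.Bijective φ := by
    constructor
    · intro x y h
      simp only [φ, Fin.mk.injEq] at h
      exact Subtype.ext (hs.inj _ _ h (x.2.trans y.2.symm))
    · intro i
      have : (i : ℕ) ∈ C.image r := by rw [h1]; simp
      obtain ⟨x, hx, hx2⟩ := mem_image.1 this
      exact ⟨⟨x, (hmem x).1 hx⟩, Fin.ext hx2⟩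
  let e0 := Equiv.ofBijective φ hφ
  refine ⟨C.card, (Equiv.sumCongr e0.symm (Equiv.refl _)).trans (Equiv.sumCompl (fun x => c x = 0)),
    ?_, ?_, ?_, hlt⟩
  · intro i
    have : φ (e0.symm i) = i := e0.apply_symm_apply i
    have := congrArg Fin.val this
    simpa [φ] using this
  · intro i
    simpa using (e0.symm i).2
  · intro y
    simp

lemma comb_identity (r c : α → ℕ) (hs : IsShape r c) (l : ℕ) (e : Fin l ⊕ {x // ¬ c x = 0} ≃ α)
    (h1 : ∀ i, r (e (Sum.inl i)) = i) (h2 : ∀ i, c (e (Sum.inl i)) = 0)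
    (h3 : ∀ y, e (Sum.inr y) = y.1) (hl : ∀ x, r x < l) :
    ∏ x, ((l : ℤ) + c x - r x) = (∏ i, (hk r c (e (Sum.inl i)) : ℤ)) *
      ∏ y : {x // ¬ c x = 0}, ((l : ℤ) + ((c y.1 - 1 : ℕ) : ℤ) - r y.1) := by
  rw [← e.prod_comp, Fintype.prod_sum_type]
  simp only [h1, h2, h3]
  let g : {x // ¬ c x = 0} → Fin l := fun y => ⟨r y.1, hl y.1⟩
  rw [← Finset.prod_fiberwise univ g, ← Finset.prod_fiberwise univ g, ← Finset.prod_mul_distrib,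
    ← Finset.prod_mul_distrib]
  refine Finset.prod_congr rfl fun i _ => ?_
  set B := univ.filter (fun y => g y = i) with hB
  have hmem : ∀ y, y ∈ B ↔ r y.1 = i := by simp [hB, g, Fin.ext_iff]
  have hinj : Set.InjOn (fun y : {x // ¬ c x = 0} => c y.1 - 1) B := by
    intro y hy z hz h
    rw [mem_coe, hmem] at hy hz
    have := y.2
    have := z.2
    simp only at h
    exact Subtype.ext (hs.inj _ _ (hy.trans hz.symm) (by omega))
  have himg : B.image (fun y : {x // ¬ c x = 0} => c y.1 - 1) = range B.card := by
    have := lower_eq_range (B.image (fun y : {x // ¬ c x = 0} => c y.1 - 1)) (by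
      intro x hx j hj
      simp only [mem_image, hmem] at *
      obtain ⟨y, hy, rfl⟩ := hx
      obtain ⟨z, h1, h2⟩ := (shape_sub r c hs).lower y (r y.1) j le_rfl hj
      exact ⟨z, h1.trans hy, h2⟩)
    rwa [Finset.card_image_of_injOn hinj] at this
  have hhk : (hk r c (e (Sum.inl i)) : ℤ) = l + B.card - i := by
    unfold hk
    rw [h1, h2, card_sub c _ (fun x (hx : r x = i ∧ 0 < c x) => by omega)]
    have e1 : (univ.filter (fun y : {x // ¬ c x = 0} => r y.1 = i ∧ 0 < c y.1)) = B := by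
      ext y
      have := y.2
      rw [hmem]
      simp only [mem_filter, mem_univ, true_and]
      omega
    have e2 : (univ.filter (fun y => c y = 0 ∧ (i : ℕ) < r y)).card = l - i - 1 := by
      rw [← Nat.card_Ioo]
      refine Finset.card_bij (fun y _ => r y) ?_ ?_ ?_
      · intro y hy
        simp only [mem_filter, mem_univ, true_and, mem_Ioo] at *
        exact ⟨hy.2, hl y⟩
      · intro y hy z hz h
        simp only [mem_filter, mem_univ, true_and] at *
        exact hs.inj _ _ h (hy.1.trans hz.1.symm)
      · intro j hj
        rw [mem_Ioo] at hj
        refine ⟨e (Sum.inl ⟨j, hj.2⟩), ?_, h1 _⟩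
        simp [h1, h2, hj.1]
    rw [e1, e2]
    have := i.2
    omega
  have p1 : ∏ y ∈ B, ((l : ℤ) + c y.1 - r y.1) = ∏ j ∈ range B.card, ((l : ℤ) + (j + 1) - i) := by
    rw [← himg, Finset.prod_image hinj]
    refine Finset.prod_congr rfl fun y hy => ?_
    have := y.2
    rw [hmem] at hy
    omega
  have p2 : ∏ y ∈ B, ((l : ℤ) + ((c y.1 - 1 : ℕ) : ℤ) - r y.1) =
      ∏ j ∈ range B.card, ((l : ℤ) + j - i) := by
    rw [← himg, Finset.prod_image hinj]
    refine Finset.prod_congr rfl fun y hy => ?_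
    rw [hmem] at hy
    omega
  rw [p1, p2, hhk]
  have q1 := Finset.prod_range_succ (fun j : ℕ => (l : ℤ) + j - i) B.card
  have q2 := Finset.prod_range_succ' (fun j : ℕ => (l : ℤ) + j - i) B.card
  push_cast at q2 q1 ⊢
  rw [mul_comm, ← q2, q1, mul_comm]

end

theorem main_aux (k : Type*) [Field k] [CharZero k] (n : ℕ) :
    ∀ (α : Type) [Fintype α] [DecidableEq α] (r c : α → ℕ),
    Fintype.card α = n → IsShape r c →
    (bE k c * aE k r) * (bE k c * aE k r) = ((∏ x, hk r c x : ℕ) : k) • (bE k c * aE k r) := by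
  induction n using Nat.strong_induction_on with
  | _ n ih =>
  intro α _ _ r c hn hs
  rcases isEmpty_or_nonempty α with hα | ⟨⟨x0⟩⟩
  · have h1 : ∀ r : α → ℕ, VS r = {1} := by
      intro r; ext σ; simp [mem_VS, Subsingleton.elim σ 1]
    have hb : bE k c = 1 := by simp [bE, h1, MonoidAlgebra.one_def]
    have ha : aE k r = 1 := by simp [aE, h1, MonoidAlgebra.one_def]
    simp [ha, hb]
  · obtain ⟨l, e, h1, h2, h3, hl⟩ := exists_first_col r c hs
    obtain ⟨m, hm⟩ := exists_scalar k r c hs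
    have hcard : Fintype.card {x // ¬ c x = 0} < n := by
      rw [← hn]
      obtain ⟨y, -, hy⟩ := hs.lower x0 0 0 (Nat.zero_le _) (Nat.zero_le _)
      exact Fintype.card_subtype_lt (x := y) (by simpa using hy)
    have hs' := shape_sub r c hs
    have IH := ih _ hcard {x // ¬ c x = 0} _ _ rfl hs'
    obtain ⟨A1, A2⟩ := scalar_rank k l r c hs hl m hm
    obtain ⟨B1, B2⟩ := scalar_rank k l _ _ hs' (fun y => hl y.1) _ IH
    have hVS : VS ((c ∘ e) ∘ Sum.inr) = VS (fun z : {x // ¬ c x = 0} => c z.1 - 1) := by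
      ext σ
      rw [mem_VS, mem_VS]
      refine forall_congr' fun y => ?_
      simp only [Function.comp_apply, h3]
      have := y.2
      have := (σ y).2
      omega
    have hPP : PP k l ((r ∘ e) ∘ Sum.inr) ((c ∘ e) ∘ Sum.inr) =
        PP k l (fun z : {x // ¬ c x = 0} => r z.1) (fun z : {x // ¬ c x = 0} => c z.1 - 1) := by
      funext f
      unfold PP
      rw [hVS]
      simp only [Function.comp_apply, h3]
    have hrank : (aM k l r * bM k l c).rank =
        (aM k l (fun z : {x // ¬ c x = 0} => r z.1) *
          bM k l (fun z : {x // ¬ c x = 0} => c z.1 - 1)).rank := by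
      rw [rank_eq, rank_eq, range_PP_equiv k e, span_sum k l (r ∘ e) (c ∘ e) h1 h2, hPP]
      intro y
      simpa [h3] using y.2
    rw [hm]
    congr 1
    rw [comb_identity r c hs l e h1 h2 h3 hl, Int.cast_mul, B1, hrank] at A1
    have hR : ((aM k l (fun z : {x // ¬ c x = 0} => r z.1) *
          bM k l (fun z : {x // ¬ c x = 0} => c z.1 - 1)).rank : k) ≠ 0 := by
      intro h
      rw [B1, h, mul_zero] at B2
      exact B2 rfl
    rw [← mul_assoc] at A1
    rw [← mul_right_cancel₀ hR A1, ← e.prod_comp, Fintype.prod_sum_type]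
    simp only [h3, hk_sub]
    push_cast
    rfl

end aux

section final
open Equiv Finset

lemma shape_of_tableau (μ : YoungDiagram) (T : {c // c ∈ μ.cells} ≃ Fin n) :
    IsShape (fun x : Fin n => ((T.symm x : ℕ × ℕ)).1) (fun x : Fin n => ((T.symm x : ℕ × ℕ)).2) := by
  refine ⟨fun x y h1 h2 => ?_, fun x i j h1 h2 => ?_⟩
  · exact T.symm.injective (Subtype.ext (Prod.ext h1 h2))
  · have hx : ((T.symm x : ℕ × ℕ)) ∈ μ := (T.symm x).2
    have hm : (i, j) ∈ μ := μ.up_left_mem h1 h2 hx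
    exact ⟨T ⟨(i, j), hm⟩, by simp, by simp⟩

lemma hk_tableau (μ : YoungDiagram) (T : {c // c ∈ μ.cells} ≃ Fin n) (x : Fin n) :
    hk (fun x : Fin n => ((T.symm x : ℕ × ℕ)).1) (fun x : Fin n => ((T.symm x : ℕ × ℕ)).2) x =
      (μ.rowLen (T.symm x : ℕ × ℕ).1 - (T.symm x : ℕ × ℕ).2) +
        (μ.colLen (T.symm x : ℕ × ℕ).2 - (T.symm x : ℕ × ℕ).1) - 1 := by
  have hs := shape_of_tableau μ T
  have hmem : ∀ y, ((T.symm y : ℕ × ℕ)) ∈ μ := fun y => (T.symm y).2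
  have hr : ∀ y, (T.symm y : ℕ × ℕ).2 < μ.rowLen (T.symm y : ℕ × ℕ).1 := fun y =>
    YoungDiagram.mem_iff_lt_rowLen.1 (hmem y)
  have hc : ∀ y, (T.symm y : ℕ × ℕ).1 < μ.colLen (T.symm y : ℕ × ℕ).2 := fun y =>
    YoungDiagram.mem_iff_lt_colLen.1 (hmem y)
  unfold hk
  have e1 : (univ.filter (fun y : Fin n => (T.symm y : ℕ × ℕ).1 = (T.symm x : ℕ × ℕ).1 ∧
      (T.symm x : ℕ × ℕ).2 < (T.symm y : ℕ × ℕ).2)).card =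
      μ.rowLen (T.symm x : ℕ × ℕ).1 - (T.symm x : ℕ × ℕ).2 - 1 := by
    rw [← Nat.card_Ioo]
    refine Finset.card_bij (fun y _ => (T.symm y : ℕ × ℕ).2) ?_ ?_ ?_
    · intro y hy
      simp only [mem_filter, mem_univ, true_and, mem_Ioo] at *
      refine ⟨hy.2, ?_⟩
      rw [← hy.1]
      exact hr y
    · intro y hy z hz h
      simp only [mem_filter, mem_univ, true_and] at *
      exact hs.inj _ _ (hy.1.trans hz.1.symm) h
    · intro j hj
      rw [mem_Ioo] at hj
      have hm : ((T.symm x : ℕ × ℕ).1, j) ∈ μ := YoungDiagram.mem_iff_lt_rowLen.2 hj.2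
      exact ⟨T ⟨_, hm⟩, by simp [hj.1], by simp⟩
  have e2 : (univ.filter (fun y : Fin n => (T.symm y : ℕ × ℕ).2 = (T.symm x : ℕ × ℕ).2 ∧
      (T.symm x : ℕ × ℕ).1 < (T.symm y : ℕ × ℕ).1)).card =
      μ.colLen (T.symm x : ℕ × ℕ).2 - (T.symm x : ℕ × ℕ).1 - 1 := by
    rw [← Nat.card_Ioo]
    refine Finset.card_bij (fun y _ => (T.symm y : ℕ × ℕ).1) ?_ ?_ ?_
    · intro y hy
      simp only [mem_filter, mem_univ, true_and, mem_Ioo] at *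
      refine ⟨hy.2, ?_⟩
      rw [← hy.1]
      exact hc y
    · intro y hy z hz h
      simp only [mem_filter, mem_univ, true_and] at *
      exact hs.inj _ _ h (hy.1.trans hz.1.symm)
    · intro j hj
      rw [mem_Ioo] at hj
      have hm : (j, (T.symm x : ℕ × ℕ).2) ∈ μ := YoungDiagram.mem_iff_lt_colLen.2 hj.2
      exact ⟨T ⟨_, hm⟩, by simp [hj.1], by simp⟩
  rw [e1, e2]
  have := hr x
  have := hc x
  omega

lemma youngSymmetrizer_eq (k : Type*) [Field k] (μ : YoungDiagram)
    (T : {c // c ∈ μ.cells} ≃ Fin n) :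
    youngSymmetrizer k μ T =
      ((∏ x, hk (fun x : Fin n => ((T.symm x : ℕ × ℕ)).1)
        (fun x : Fin n => ((T.symm x : ℕ × ℕ)).2) x : ℕ) : k)⁻¹ •
      (bE k (fun x : Fin n => ((T.symm x : ℕ × ℕ)).2) *
        aE k (fun x : Fin n => ((T.symm x : ℕ × ℕ)).1)) := by
  classical
  have hκ : ∏ x, hk (fun x : Fin n => ((T.symm x : ℕ × ℕ)).1)
        (fun x : Fin n => ((T.symm x : ℕ × ℕ)).2) x =
      ∏ c ∈ μ.cells, ((μ.rowLen c.1 - c.2) + (μ.colLen c.2 - c.1) - 1) := by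
    rw [← Finset.prod_coe_sort μ.cells]; conv_rhs => rw [← T.symm.prod_comp]
    exact Finset.prod_congr rfl fun x _ => hk_tableau μ T x
  have hV : ∀ r : Fin n → ℕ, ∀ inst : DecidablePred (fun σ : Perm (Fin n) => σ ∈ stabOf r),
      @Finset.filter _ (fun σ : Perm (Fin n) => σ ∈ stabOf r) inst univ = VS r := by
    intro r inst
    ext σ
    rw [mem_filter, mem_VS]
    simp only [mem_univ, true_and]
    rfl
  rw [hκ]
  unfold youngSymmetrizer bE aE
  simp only [hV]
  congr 1
  rw [Finset.sum_mul]
  refine Finset.sum_congr rfl fun v _ => ?_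
  rw [Finset.mul_sum]
  refine Finset.sum_congr rfl fun h _ => ?_
  rw [MonoidAlgebra.single_mul_single, mul_one]

end final

/-- Over a field `k` of characteristic zero, the normalized Young symmetrizer
`e_T = κ_ρ⁻¹ Σ_{v ∈ V(T)} Σ_{h ∈ H(T)} sgn(v) · v h ∈ k[𝔖_n]` associated to a Young tableau
`T` of shape the partition `ρ` (a Young diagram with `n` boxes) is an idempotent. -/
theorem stmt6 (k : Type*) [Field k] [CharZero k] (μ : YoungDiagram) (hμ : μ.card = n)
    (T : {c // c ∈ μ.cells} ≃ Fin n) :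
    youngSymmetrizer k μ T * youngSymmetrizer k μ T = youngSymmetrizer k μ T := by
  have h := main_aux k _ (Fin n) _ _ rfl (shape_of_tableau μ T)
  rw [youngSymmetrizer_eq, smul_mul_smul_comm, h, smul_smul]
  congr 1
  have hne : ((∏ x, hk (fun x : Fin n => ((T.symm x : ℕ × ℕ)).1)
        (fun x : Fin n => ((T.symm x : ℕ × ℕ)).2) x : ℕ) : k) ≠ 0 := by
    rw [Nat.cast_ne_zero, Finset.prod_ne_zero_iff]
    intro x _
    simp [hk]
  field_simp

end Stmt6
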